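/- arXiv:0709.4154 — 2 statements merged into one kernel-verified Lean document; each statement's English description precedes it below -/
import Mathlib

section
/- Fix an integer d ≥ 2 and a natural number s. There exists a real constant C > 0, depending only on d and s, with the following property: for every rational number c such that the number of Type II primes of φ(z) = z^d + c equals s, for every wandering point α ∈ ℚ of φ, and for every real number L such that h(φ^[k](α))/d^k tends to L as k → ∞, one has L ≥ C · max(h(c), 1). -/
open Filter

/-- The absolute logarithmic height of a rational number. -/
noncomputable def ratHeight (q : ℚ) : ℝ := Real.log (max (|q.num| : ℝ) (q.den : ℝ))

lemma np_pow (p : ℕ) [Fact p.Prime] (z : ℚ) (n : ℕ) : padicNorm p (z ^ n) = padicNorm p z ^ n := by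
  induction n with
  | zero => simp
  | succ n ih => rw [pow_succ, pow_succ, padicNorm.mul, ih]

lemma np_prod (p : ℕ) [Fact p.Prime] {ι : Type*} (s : Finset ι) (f : ι → ℚ) :
    padicNorm p (∏ i ∈ s, f i) = ∏ i ∈ s, padicNorm p (f i) := by
  classical
  induction s using Finset.induction_on with
  | empty => simp
  | insert a s ha ih => rw [Finset.prod_insert ha, Finset.prod_insert ha, padicNorm.mul, ih]

lemma np_pow_diff (p : ℕ) [Fact p.Prime] {z w R : ℚ} (hz : padicNorm p z = R)
    (hw : padicNorm p w = R) (hR : 0 < R) (i : ℕ) :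
    padicNorm p (z ^ i - w ^ i) * R ≤ padicNorm p (z - w) * R ^ i := by
  induction i with
  | zero => simpa using padicNorm.nonneg _
  | succ n ih =>
    have h : z ^ (n+1) - w ^ (n+1) = z * (z ^ n - w ^ n) + (z - w) * w ^ n := by ring
    have h2 := padicNorm.nonarchimedean (p := p) (q := z * (z ^ n - w ^ n)) (r := (z - w) * w ^ n)
    rw [← h, padicNorm.mul, padicNorm.mul, np_pow, hz, hw] at h2
    rcases le_max_iff.1 h2 with h3 | h3
    · calc _ ≤ R * padicNorm p (z ^ n - w ^ n) * R := by gcongr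
        _ = R * (padicNorm p (z ^ n - w ^ n) * R) := by ring
        _ ≤ R * (padicNorm p (z - w) * R ^ n) := by gcongr
        _ = _ := by ring
    · calc _ ≤ padicNorm p (z - w) * R ^ n * R := by gcongr
        _ = _ := by ring

lemma close_step (p : ℕ) [Fact p.Prime] (d : ℕ) (hd : 2 ≤ d) {z w R : ℚ} (hz : padicNorm p z = R)
    (hw : padicNorm p w = R) (hR : 0 < R) (h : padicNorm p (z - w) < padicNorm p d * R) :
    padicNorm p (z - w) * (padicNorm p d * R ^ (d - 1)) ≤ padicNorm p (z ^ d - w ^ d) := by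
  have hd0 : 0 < padicNorm p d := 
    lt_of_le_of_ne (padicNorm.nonneg _) (padicNorm.nonzero (by positivity)).symm
  set S := ∑ i ∈ Finset.range d, z ^ i * w ^ (d - 1 - i) with hS
  have h1 : S * (z - w) = z ^ d - w ^ d := by
    rw [hS]; exact geom_sum₂_mul z w d
  have h2 : S - d * w ^ (d - 1) = ∑ i ∈ Finset.range d, (z ^ i - w ^ i) * w ^ (d - 1 - i) := by
    rw [hS]
    have : ∀ i ∈ Finset.range d, (z ^ i - w ^ i) * w ^ (d - 1 - i) =
      z ^ i * w ^ (d - 1 - i) - w ^ (d - 1) := by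
      intro i hi
      rw [Finset.mem_range] at hi
      rw [sub_mul, ← pow_add]
      congr 2
      omega
    rw [Finset.sum_congr rfl this, Finset.sum_sub_distrib]
    simp
  have h3 : padicNorm p (S - d * w ^ (d - 1)) < padicNorm p d * R ^ (d - 1) := by
    rw [h2]
    apply padicNorm.sum_lt'
    · intro i hi
      rw [Finset.mem_range] at hi
      have := np_pow_diff p hz hw hR i
      rw [padicNorm.mul, np_pow, hw]
      have h5 : R * (padicNorm p (z ^ i - w ^ i) * R ^ (d - 1 - i)) < R * (padicNorm p d * R ^ (d - 1)) := by
        calc _ = padicNorm p (z ^ i - w ^ i) * R * R ^ (d - 1 - i) := by ring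
          _ ≤ padicNorm p (z - w) * R ^ i * R ^ (d - 1 - i) := by gcongr
          _ = padicNorm p (z - w) * R ^ (d - 1) := by
            rw [mul_assoc, ← pow_add]; congr 2; omega
          _ < (padicNorm p d * R) * R ^ (d - 1) := by gcongr
          _ = _ := by ring
      exact lt_of_mul_lt_mul_left h5 hR.le
    · positivity
  have h4 : padicNorm p d * R ^ (d - 1) ≤ padicNorm p S := by
    by_contra hc
    push Not at hc
    have h6 := padicNorm.sub (p := p) (q := S) (r := S - d * w ^ (d - 1))
    rw [sub_sub_cancel, padicNorm.mul, np_pow, hw] at h6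
    exact absurd h6 (not_le.2 (max_lt hc h3))
  rw [← h1, padicNorm.mul, mul_comm]
  gcongr
  exact padicNorm.nonneg _

lemma lagr (d : ℕ) (hd : 2 ≤ d) (c : ℚ) (v : Fin (d+1) → ℚ) (hv : Function.Injective v) :
    (1:ℚ) = ∑ i, (v i ^ d + c) / ∏ j ∈ Finset.univ.erase i, (v i - v j) := by
  have hdeg : (Polynomial.X ^ d + Polynomial.C c : Polynomial ℚ).degree = d :=
    Polynomial.degree_X_pow_add_C (by omega) c
  have := Lagrange.leadingCoeff_eq_sum (s := Finset.univ) (v := v) hv.injOn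
    (P := Polynomial.X ^ d + Polynomial.C c) (by rw [hdeg]; simp)
  rw [Polynomial.leadingCoeff_X_pow_add_C (by omega)] at this
  simpa using this

lemma classes (p : ℕ) [Fact p.Prime] (d : ℕ) (hd : 2 ≤ d) (c : ℚ) (x : ℕ → ℚ)
    (hx : ∀ k, x (k+1) = x k ^ d + c) (hinj : Function.Injective x) (R : ℚ) (hR : 0 < R) (M : ℕ)
    (hM : ∀ k ≤ M + 1, padicNorm p (x k) = R) (hbig : ¬ (padicNorm p d ^ 2 * R ≤ 1)) :
    ∃ f : ℕ → Fin d, ∀ i ≤ M, ∀ j ≤ M, f i = f j → padicNorm p (x i - x j) < padicNorm p d * R := by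
  classical
  have hd0 : 0 < padicNorm p d := 
    lt_of_le_of_ne (padicNorm.nonneg _) (padicNorm.nonzero (by positivity)).symm
  have hd1 : padicNorm p d ≤ 1 := padicNorm.of_nat d
  let st : Setoid (Fin (M+1)) :=
    { r := fun i j => padicNorm p (x i - x j) < padicNorm p d * R
      iseqv := by
        refine ⟨fun i => by simp; positivity, fun {i j} h => ?_, fun {i j k} h1 h2 => ?_⟩
        · rw [← padicNorm.neg, neg_sub]; exact h
        · have := padicNorm.nonarchimedean (p := p) (q := x i - x j) (r := x j - x k)
          rw [sub_add_sub_cancel] at this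
          exact this.trans_lt (max_lt h1 h2) }
  by_cases hcard : Fintype.card (Quotient st) ≤ d
  · obtain ⟨g⟩ : Nonempty (Quotient st ↪ Fin d) := 
      Function.Embedding.nonempty_of_card_le (by simpa using hcard)
    refine ⟨fun i => g (Quotient.mk st (Fin.ofNat (M+1) i)), fun i hi j hj h => ?_⟩
    have h1 := Quotient.exact (g.injective h)
    change padicNorm p (x (Fin.ofNat (M+1) i) - x (Fin.ofNat (M+1) j)) < _ at h1
    simpa [Nat.mod_eq_of_lt (Nat.lt_succ_of_le hi), Nat.mod_eq_of_lt (Nat.lt_succ_of_le hj)] using h1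
  · exfalso
    push Not at hcard
    obtain ⟨g⟩ : Nonempty (Fin (d+1) ↪ Quotient st) := 
      Function.Embedding.nonempty_of_card_le (by simpa using hcard)
    let u : Fin (d+1) → Fin (M+1) := fun i => (g i).out
    have hu : ∀ i j, i ≠ j → padicNorm p d * R ≤ padicNorm p (x (u i) - x (u j)) := by
      intro i j hij
      by_contra hc
      push Not at hc
      apply hij
      apply g.injective
      have : st.r (g i).out (g j).out := hc
      exact Quotient.out_equiv_out.1 this
    have hL := lagr d hd c (fun i => x (u i)) (by
      intro i j hij
      by_contra hne
      have := hu i j hne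
      simp only at hij
      rw [hij] at this
      simp at this
      exact absurd this (not_le.2 (by positivity)))
    have hlt : padicNorm p (1:ℚ) < 1 := by
      conv_lhs => rw [hL]
      apply padicNorm.sum_lt' _ one_pos
      intro i _
      rw [← hx, padicNorm.div, hM _ (by have := (u i).2; omega), np_prod]
      have hpr : (padicNorm p d * R) ^ d ≤ ∏ j ∈ Finset.univ.erase i, padicNorm p (x (u i) - x (u j)) := by
        have : d = (Finset.univ.erase i).card := by simp
        conv_lhs => rw [this]
        rw [← Finset.prod_const]
        apply Finset.prod_le_prod
        · intros; rw [← this]; positivity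
        · intro j hj
          rw [← this]
          exact hu i j (Finset.ne_of_mem_erase hj).symm
      rw [div_lt_one (lt_of_lt_of_le (by positivity) hpr)]
      refine lt_of_lt_of_le ?_ hpr
      push Not at hbig
      have h1 : 1 < (padicNorm p d ^ 2 * R) ^ (d - 1) := one_lt_pow₀ hbig (by omega)
      have h2 : padicNorm p d ^ (2 * (d-1)) ≤ padicNorm p d ^ d := 
        pow_le_pow_of_le_one hd0.le hd1 (by omega)
      calc R = 1 * R := by ring
        _ < (padicNorm p d ^ 2 * R) ^ (d - 1) * R := by gcongr
        _ = padicNorm p d ^ (2 * (d-1)) * (R ^ (d-1) * R) := by rw [mul_pow, ← pow_mul]; ring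
        _ ≤ padicNorm p d ^ d * (R ^ (d-1) * R) := by gcongr
        _ = _ := by rw [← pow_succ, mul_pow]; congr 2; omega
    simp at hlt

lemma local_nonescape (p : ℕ) [Fact p.Prime] (d : ℕ) (hd : 2 ≤ d) (c : ℚ) (x : ℕ → ℚ)
    (hx : ∀ k, x (k+1) = x k ^ d + c) (hinj : Function.Injective x) (R : ℚ) (hR : 1 ≤ R) (M : ℕ)
    (hM : ∀ k ≤ M + 2, padicNorm p (x k) = R) :
    ∃ f : ℕ → Fin d × Fin d, ∀ i ≤ M, ∀ j ≤ M, f i = f j →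
      padicNorm p (x i - x j) * padicNorm p d ^ 4 * R ≤ 1 := by
  have hR0 : 0 < R := by linarith
  have hd0 : 0 < padicNorm p d := 
    lt_of_le_of_ne (padicNorm.nonneg _) (padicNorm.nonzero (by positivity)).symm
  have hd1 : padicNorm p d ≤ 1 := padicNorm.of_nat d
  have htriv : ∀ i ≤ M + 2, ∀ j ≤ M + 2, padicNorm p (x i - x j) ≤ R := by
    intro i hi j hj
    refine padicNorm.sub.trans ?_
    rw [hM i hi, hM j hj, max_self]
  by_cases hs : padicNorm p d ^ 2 * R ≤ 1
  · refine ⟨fun _ => (⟨0, by omega⟩, ⟨0, by omega⟩), fun i hi j hj _ => ?_⟩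
    have := htriv i (by omega) j (by omega)
    calc _ ≤ R * padicNorm p d ^ 4 * R := by gcongr
      _ = (padicNorm p d ^ 2 * R) ^ 2 := by ring
      _ ≤ 1 := pow_le_one₀ (by positivity) hs
  · obtain ⟨f, hf⟩ := classes p d hd c x hx hinj R hR0 (M+1) hM hs
    refine ⟨fun i => (f i, f (i+1)), fun i hi j hj hij => ?_⟩
    rw [Prod.mk.injEq] at hij
    have c0 := hf i (by omega) j (by omega) hij.1
    have c1 := hf (i+1) (by omega) (j+1) (by omega) hij.2
    have s0 := close_step p d hd (hM i (by omega)) (hM j (by omega)) hR0 c0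
    have s1 := close_step p d hd (hM (i+1) (by omega)) (hM (j+1) (by omega)) hR0 c1
    have e0 : x i ^ d - x j ^ d = x (i+1) - x (j+1) := by rw [hx, hx]; ring
    have e1 : x (i+1) ^ d - x (j+1) ^ d = x (i+2) - x (j+2) := by rw [hx (i+1), hx (j+1)]; ring
    rw [e0] at s0
    rw [e1] at s1
    have s2 := s1.trans (htriv (i+2) (by omega) (j+2) (by omega))
    set n := padicNorm p (x i - x j)
    have hn : 0 ≤ n := padicNorm.nonneg _
    set D := padicNorm p d
    have s3 : n * (D * R ^ (d-1)) * (D * R ^ (d-1)) ≤ R := le_trans (by gcongr) s2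
    obtain ⟨m, rfl⟩ : ∃ m, d = m + 2 := ⟨d - 2, by omega⟩
    have e : m + 2 - 1 = m + 1 := rfl
    rw [e] at s3
    have s4 : n * D ^ 2 * R * (R ^ m) ^ 2 ≤ 1 := by
      have : (n * D ^ 2 * R * (R ^ m) ^ 2) * R ≤ 1 * R := by
        refine le_trans (le_of_eq ?_) (s3.trans_eq (one_mul R).symm); ring
      exact le_of_mul_le_mul_right this hR0
    have hRm : 1 ≤ (R ^ m) ^ 2 := one_le_pow₀ (one_le_pow₀ hR)
    have hD4 : D ^ 4 ≤ D ^ 2 := pow_le_pow_of_le_one hd0.le hd1 (by omega)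
    calc n * D ^ 4 * R ≤ n * D ^ 2 * R := by gcongr
      _ = n * D ^ 2 * R * 1 := by ring
      _ ≤ n * D ^ 2 * R * (R ^ m) ^ 2 := by gcongr
      _ ≤ 1 := s4

section
variable (p : ℕ) [Fact p.Prime] (d : ℕ) (hd : 2 ≤ d) (c : ℚ) (x : ℕ → ℚ)
    (hx : ∀ k, x (k+1) = x k ^ d + c)

def mx (p : ℕ) (q : ℚ) : ℚ := max 1 (padicNorm p q)

lemma one_le_mx (p : ℕ) (q : ℚ) : 1 ≤ mx p q := le_max_left _ _

lemma np_le_mx (p : ℕ) (q : ℚ) : padicNorm p q ≤ mx p q := le_max_right _ _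

lemma mx_of_one_lt {p : ℕ} {q : ℚ} (h : 1 < mx p q) : mx p q = padicNorm p q := by
  unfold mx at *
  rcases lt_max_iff.1 h with h | h
  · exact absurd h (lt_irrefl _)
  · exact max_eq_right h.le

lemma F1 (hd : 2 ≤ d) (z : ℚ) (h : mx p c < mx p z ^ d) : mx p (z ^ d + c) = mx p z ^ d := by
  have h1 : 1 < mx p z := by
    rcases (one_le_mx p z).lt_or_eq with h1 | h1
    · exact h1
    · rw [← h1, one_pow] at h
      exact absurd h (not_lt.2 (one_le_mx p c))
  have h2 := mx_of_one_lt h1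
  have h3 : padicNorm p c < padicNorm p (z ^ d) := by
    rw [np_pow, ← h2]; exact (np_le_mx p c).trans_lt h
  rw [mx, padicNorm.add_eq_max_of_ne h3.ne', max_eq_left h3.le, np_pow, ← h2]
  exact max_eq_right (one_le_pow₀ h1.le)

lemma F2 (hd : 2 ≤ d) (z : ℚ) (h : mx p z ^ d < mx p c) : mx p (z ^ d + c) = mx p c := by
  have h1 : 1 < mx p c := (one_le_pow₀ (one_le_mx p z)).trans_lt h
  have h2 := mx_of_one_lt h1
  have h3 : padicNorm p (z ^ d) < padicNorm p c := by
    rw [np_pow, ← h2]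
    exact (pow_le_pow_left₀ (padicNorm.nonneg _) (np_le_mx p z) d).trans_lt h
  rw [mx, padicNorm.add_eq_max_of_ne h3.ne, max_eq_right h3.le, ← h2]
  exact max_eq_right h1.le

include hx in
lemma F1_iter (hd : 2 ≤ d) (k : ℕ) (h : mx p c < mx p (x k) ^ d) (m : ℕ) :
    mx p (x (k+m)) = mx p (x k) ^ (d ^ m) := by
  induction m with
  | zero => simp
  | succ m ih =>
    rw [← add_assoc, hx, F1 p d c hd, ih, ← pow_mul, ← pow_succ]
    rw [ih, ← pow_mul, ← pow_succ]
    refine h.trans_le (pow_le_pow_right₀ (one_le_mx _ _) ?_)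
    exact Nat.le_self_pow (by omega) d

include hx in
lemma esc (hd : 2 ≤ d) (k : ℕ) (h : mx p (x k) ^ d ≠ mx p c) (m : ℕ) (hm : 1 ≤ m) :
    mx p c ^ (d ^ m) ≤ mx p (x (k+m)) ^ d := by
  rcases lt_or_gt_of_ne h with h | h
  · have h1 : mx p (x (k+1)) = mx p c := by rw [hx]; exact F2 p d c hd _ h
    have h2 : 1 < mx p c := (one_le_pow₀ (one_le_mx p _)).trans_lt h
    have h3 := F1_iter p d c x hx hd (k+1) (by rw [h1]; exact lt_self_pow₀ h2 (by omega)) (m-1)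
    have e : k + 1 + (m - 1) = k + m := by omega
    rw [e, h1] at h3
    rw [h3, ← pow_mul, ← pow_succ, Nat.sub_add_cancel hm]
  · rw [F1_iter p d c x hx hd k h m, ← pow_mul, mul_comm, pow_mul]
    exact pow_le_pow_left₀ (by linarith [one_le_mx p c]) h.le _

include hx in
lemma esc_ineq (hd : 2 ≤ d) (M : ℕ) (h : ∃ k ≤ M + 2, mx p (x k) ^ d ≠ mx p c)
    (i : ℕ) (hi : i ≤ M) (j : ℕ) (hj : j ≤ M) (K : ℕ) (hK : M + 3 ≤ K) :
    (padicNorm p (x i - x j) ^ d * padicNorm p d ^ (4 * d) * mx p c) ^ (d ^ (K - (M+2)))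
      ≤ mx p (x K) ^ (d * d + d) := by
  obtain ⟨k, hk, h⟩ := h
  set T := d ^ (K - (M+2)) with hT
  have hE : mx p c ^ T ≤ mx p (x K) ^ d := by
    have := esc p d c x hx hd k h (K - k) (by omega)
    rw [show k + (K - k) = K by omega] at this
    refine le_trans (pow_le_pow_right₀ (one_le_mx _ _) ?_) this
    exact Nat.pow_le_pow_right (by omega) (by omega)
  have hX : ∀ i ≤ M, mx p (x i) ^ T ≤ mx p (x K) ^ d := by
    intro i hi
    by_cases h1 : mx p c < mx p (x i) ^ d
    · have := F1_iter p d c x hx hd i h1 (K - i)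
      rw [show i + (K - i) = K by omega] at this
      calc _ ≤ mx p (x i) ^ (d ^ (K - i)) := 
            pow_le_pow_right₀ (one_le_mx _ _) (Nat.pow_le_pow_right (by omega) (by omega))
        _ = mx p (x K) := this.symm
        _ ≤ _ := le_self_pow₀ (one_le_mx _ _) (by omega)
    · push Not at h1
      have h2 : mx p (x i) ≤ mx p c := (le_self_pow₀ (one_le_mx _ _) (by omega)).trans h1
      exact (pow_le_pow_left₀ (by linarith [one_le_mx p (x i)]) h2 _).trans hE
  have hn : padicNorm p (x i - x j) ^ T ≤ mx p (x K) ^ d := by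
    have := padicNorm.sub (p := p) (q := x i) (r := x j)
    rcases le_max_iff.1 this with h1 | h1
    · exact (pow_le_pow_left₀ (padicNorm.nonneg _) (h1.trans (np_le_mx _ _)) _).trans (hX i hi)
    · exact (pow_le_pow_left₀ (padicNorm.nonneg _) (h1.trans (np_le_mx _ _)) _).trans (hX j hj)
  have hn0 : 0 ≤ padicNorm p (x i - x j) := padicNorm.nonneg _
  have hD : padicNorm p d ^ (4 * d * T) ≤ 1 := pow_le_one₀ (padicNorm.nonneg _) (padicNorm.of_nat d)
  have hD0 : 0 ≤ padicNorm p d := padicNorm.nonneg _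
  have hE0 := one_le_mx p c
  have hXK := one_le_mx p (x K)
  calc _ = (padicNorm p (x i - x j) ^ T) ^ d * padicNorm p d ^ (4 * d * T) * mx p c ^ T := by
        rw [mul_pow, mul_pow, ← pow_mul, ← pow_mul, ← pow_mul, mul_comm d T]
    _ ≤ (mx p (x K) ^ d) ^ d * 1 * mx p (x K) ^ d := by gcongr
    _ = _ := by rw [← pow_mul, mul_one, pow_add]

include hx in
lemma local_good (hd : 2 ≤ d) (hII : ¬ (padicValRat p c < 0 ∧ (d:ℤ) ∣ padicValRat p c)) (M : ℕ) 
    (i : ℕ) (hi : i ≤ M) (j : ℕ) (hj : j ≤ M) (K : ℕ) (hK : M + 3 ≤ K) :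
    (padicNorm p (x i - x j) ^ d * padicNorm p d ^ (4 * d) * mx p c) ^ (d ^ (K - (M+2)))
      ≤ mx p (x K) ^ (d * d + d) := by
  by_cases h : ∃ k ≤ M + 2, mx p (x k) ^ d ≠ mx p c
  · exact esc_ineq p d c x hx hd M h i hi j hj K hK
  push Not at h
  have hn0 : 0 ≤ padicNorm p (x i - x j) := padicNorm.nonneg _
  have hD0 : 0 ≤ padicNorm p d := padicNorm.nonneg _
  rcases (one_le_mx p c).eq_or_lt with hE | hE
  · have hX : ∀ k ≤ M + 2, padicNorm p (x k) ≤ 1 := by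
      intro k hk
      have := h k hk
      rw [← hE] at this
      have h1 := (pow_eq_one_iff_of_nonneg (by linarith [one_le_mx p (x k)]) (by omega)).1 this
      rw [← h1]; exact np_le_mx _ _
    have hn : padicNorm p (x i - x j) ≤ 1 := 
      padicNorm.sub.trans (max_le (hX i (by omega)) (hX j (by omega)))
    refine le_trans ?_ (one_le_pow₀ (one_le_mx _ _))
    rw [← hE, mul_one]
    apply pow_le_one₀ (by positivity)
    exact mul_le_one₀ (pow_le_one₀ hn0 hn) (by positivity) (pow_le_one₀ hD0 (padicNorm.of_nat d))
  · exfalso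
    apply hII
    have h0 := h 0 (by omega)
    have hX : 1 < mx p (x 0) := by
      rcases (one_le_mx p (x 0)).lt_or_eq with h1 | h1
      · exact h1
      · rw [← h1, one_pow] at h0; linarith
    have hp1 : 1 < (p:ℚ) := by exact_mod_cast (Fact.out : p.Prime).one_lt
    rw [mx_of_one_lt hE] at h0 hE
    rw [mx_of_one_lt hX] at h0 hX
    have hc0 : c ≠ 0 := by rintro rfl; simp at hE; linarith
    have hx0 : x 0 ≠ 0 := by intro h; rw [h] at hX; simp at hX; linarith
    rw [padicNorm.eq_zpow_of_nonzero hc0] at h0 hE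
    rw [padicNorm.eq_zpow_of_nonzero hx0, ← zpow_natCast, ← zpow_mul] at h0
    have h1 := zpow_right_injective₀ (by linarith) hp1.ne' h0
    have h2 := (one_lt_zpow_iff_right₀ hp1).1 hE
    refine ⟨by omega, ⟨padicValRat p (x 0), ?_⟩⟩

    linarith

include hx in
lemma local_bad (hd : 2 ≤ d) (hinj : Function.Injective x) (hc : padicValRat p c < 0) (M : ℕ) :
    ∃ f : ℕ → Fin d × Fin d, ∀ i ≤ M, ∀ j ≤ M, f i = f j → ∀ K, M + 3 ≤ K →
    (padicNorm p (x i - x j) ^ d * padicNorm p d ^ (4 * d) * mx p c) ^ (d ^ (K - (M+2)))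
      ≤ mx p (x K) ^ (d * d + d) := by
  by_cases h : ∃ k ≤ M + 2, mx p (x k) ^ d ≠ mx p c
  · exact ⟨fun _ => (⟨0, by omega⟩, ⟨0, by omega⟩),
      fun i hi j hj _ K hK => esc_ineq p d c x hx hd M h i hi j hj K hK⟩
  push Not at h
  have hp1 : 1 < (p:ℚ) := by exact_mod_cast (Fact.out : p.Prime).one_lt
  have hE : 1 < mx p c := by
    refine lt_of_lt_of_le ?_ (np_le_mx _ _)
    rw [padicNorm.eq_zpow_of_nonzero (by rintro rfl; simp at hc)]
    exact one_lt_zpow₀ hp1 (by omega)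
  have hX : ∀ k ≤ M + 2, 1 < mx p (x k) := by
    intro k hk
    have h0 := h k hk
    rcases (one_le_mx p (x k)).lt_or_eq with h1 | h1
    · exact h1
    · rw [← h1, one_pow] at h0; linarith
  have hR : ∀ k ≤ M + 2, padicNorm p (x k) = mx p (x 0) := by
    intro k hk
    rw [← mx_of_one_lt (hX k hk)]
    refine (pow_left_inj₀ (by linarith [hX k hk]) (by linarith [hX 0 (by omega)]) (by omega)).1
      ((h k hk).trans (h 0 (by omega)).symm)
  obtain ⟨f, hf⟩ := local_nonescape p d hd c x hx hinj _ (one_le_mx p (x 0)) M hR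
  refine ⟨f, fun i hi j hj hij K hK => ?_⟩
  have h1 := hf i hi j hj hij
  have hn0 : 0 ≤ padicNorm p (x i - x j) := padicNorm.nonneg _
  have hD0 : 0 ≤ padicNorm p d := padicNorm.nonneg _
  have hX0 := one_le_mx p (x 0)
  refine le_trans ?_ (one_le_pow₀ (one_le_mx _ _))
  apply pow_le_one₀ (by positivity)
  rw [← h 0 (by omega), pow_mul, ← mul_pow, ← mul_pow]
  exact pow_le_one₀ (by positivity) h1
end

lemma den_norm (p : ℕ) [Fact p.Prime] (q : ℚ) : padicNorm p q.den * mx p q = 1 := by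
  have hq : padicNorm p q * padicNorm p q.den = padicNorm p q.num := by
    rw [← padicNorm.mul, Rat.mul_den_eq_num]
  by_cases h : p ∣ q.den
  · have h1 : padicNorm p q.num = 1 := by
      rw [padicNorm.int_eq_one_iff]
      intro h2
      have := Nat.dvd_gcd (Int.natCast_dvd.1 h2) h
      rw [q.reduced] at this
      exact (Fact.out : p.Prime).one_lt.ne' (Nat.dvd_one.1 this)
    have h2 : padicNorm p q.den < 1 := (padicNorm.nat_lt_one_iff _).2 h
    rw [h1] at hq
    have h3 : 1 ≤ padicNorm p q := by
      by_contra hc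
      push Not at hc
      have := mul_lt_one_of_nonneg_of_lt_one_left (padicNorm.nonneg q) hc h2.le
      linarith
    rw [mx, max_eq_right h3, mul_comm, hq]
  · have h1 : padicNorm p q.den = 1 := (padicNorm.nat_eq_one_iff _).2 h
    rw [h1, mul_one] at hq
    rw [h1, one_mul, mx, hq]
    exact max_eq_left (padicNorm.of_int _)

lemma one_le_abs_of_int (q : ℚ) (hq : q ≠ 0) (h : ∀ p : ℕ, [Fact p.Prime] → padicNorm p q ≤ 1) :
    1 ≤ |q| := by
  have hden : q.den = 1 := by
    by_contra hc
    obtain ⟨p, hp, hpd⟩ := Nat.exists_prime_and_dvd hc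
    have := Fact.mk hp
    have h1 := den_norm p q
    have h2 : padicNorm p q.den < 1 := (padicNorm.nat_lt_one_iff _).2 hpd
    rw [mx, max_eq_left (h p), mul_one] at h1
    linarith
  have : q = q.num := (Rat.coe_int_num_of_den_eq_one hden).symm
  rw [this]
  have h3 : q.num ≠ 0 := by simpa using hq
  exact_mod_cast Int.one_le_abs h3

lemma global_ineq (d : ℕ) (hd : 2 ≤ d) (c : ℚ) (x : ℕ → ℚ) (i j M K : ℕ) (hij : x i ≠ x j)
    (h : ∀ p : ℕ, [Fact p.Prime] → 
    (padicNorm p (x i - x j) ^ d * padicNorm p d ^ (4 * d) * mx p c) ^ (d ^ (K - (M+2)))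
      ≤ mx p (x K) ^ (d * d + d)) :
    0 ≤ ((d ^ (K - (M+2)) : ℕ) : ℝ) * (d * Real.log |((x i - x j : ℚ) : ℝ)| + 4 * d * Real.log d
      - Real.log c.den) + (d * d + d) * Real.log ((x K).den) := by
  set T := d ^ (K - (M+2)) with hT
  set Q : ℚ := ((x i - x j) ^ d * d ^ (4 * d) / c.den) ^ T * (x K).den ^ (d * d + d) with hQ
  have hc0 : (c.den : ℚ) ≠ 0 := by exact_mod_cast c.den_nz
  have hK0 : ((x K).den : ℚ) ≠ 0 := by exact_mod_cast (x K).den_nz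
  have hd0 : (d:ℚ) ≠ 0 := by positivity
  have hs0 : x i - x j ≠ 0 := sub_ne_zero.2 hij
  have hQ0 : Q ≠ 0 := by positivity
  have h1 : 1 ≤ |Q| := by
    apply one_le_abs_of_int Q hQ0
    intro p _
    have h2 := h p
    have hcd := den_norm p c
    have hKd := den_norm p (x K)
    have a1 := one_le_mx p c
    have a2 := one_le_mx p (x K)
    have b1 : padicNorm p c.den = (mx p c)⁻¹ := eq_inv_of_mul_eq_one_left hcd
    have b2 : padicNorm p (x K).den = (mx p (x K))⁻¹ := eq_inv_of_mul_eq_one_left hKd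
    rw [hQ, padicNorm.mul, np_pow, np_pow, padicNorm.div, padicNorm.mul, np_pow, np_pow, b1, b2,
      div_inv_eq_mul, inv_pow, ← div_eq_mul_inv]
    exact (div_le_one (by positivity)).2 h2
  have h2 : (1:ℝ) ≤ |(Q:ℝ)| := by exact_mod_cast h1
  have h3 := Real.log_nonneg h2
  have hc0' : (c.den : ℝ) ≠ 0 := by exact_mod_cast c.den_nz
  have hK0' : ((x K).den : ℝ) ≠ 0 := by exact_mod_cast (x K).den_nz
  have hd0' : (d:ℝ) ≠ 0 := by positivity
  have hs0' : ((x i - x j : ℚ) : ℝ) ≠ 0 := by exact_mod_cast hs0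
  have e : (Q:ℝ) = ((((x i - x j : ℚ) : ℝ)) ^ d * d ^ (4 * d) / c.den) ^ T * (x K).den ^ (d * d + d) := by
    rw [hQ]; push_cast; ring
  rw [Real.log_abs, e, Real.log_mul (by positivity) (by positivity), Real.log_pow, Real.log_div (by positivity) (by positivity),
    Real.log_mul (by positivity) (by positivity), Real.log_pow, Real.log_pow, Real.log_pow] at h3
  rw [Real.log_abs]
  push_cast at h3 ⊢
  exact h3

lemma real_pow_sub (d : ℕ) (hd : 2 ≤ d) {z w r : ℝ} (hr : 0 < r) (hz : r ≤ z) (hw : r ≤ w) :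
    |z - w| * r ^ (d - 1) ≤ |z ^ d - w ^ d| := by
  wlog h : w ≤ z generalizing z w
  · rw [abs_sub_comm, abs_sub_comm (z ^ d)]
    exact this hw hz (by linarith)
  have hw0 : 0 < w := by linarith
  have hz0 : 0 < z := by linarith
  have h1 : w ^ d ≤ z ^ d := by gcongr
  rw [abs_of_nonneg (by linarith), abs_of_nonneg (by linarith)]
  obtain ⟨m, rfl⟩ : ∃ m, d = m + 1 := ⟨d - 1, by omega⟩
  simp only [Nat.add_sub_cancel]
  have h2 : w ^ m ≤ z ^ m := by gcongr
  have h3 : r ^ m ≤ z ^ m := by gcongr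
  calc (z - w) * r ^ m ≤ (z - w) * z ^ m := by
        apply mul_le_mul_of_nonneg_left h3; linarith
    _ = z ^ (m+1) - w * z ^ m := by ring
    _ ≤ z ^ (m+1) - w * w ^ m := by gcongr
    _ = _ := by ring

lemma real_pow_sub' (d : ℕ) (hd : 2 ≤ d) {z w r : ℝ} (hr : 0 < r) (hz : r ≤ |z|) (hw : r ≤ |w|)
    (h : 0 ≤ z ↔ 0 ≤ w) :
    |z - w| * r ^ (d - 1) ≤ |z ^ d - w ^ d| := by
  by_cases hz0 : 0 ≤ z
  · rw [abs_of_nonneg hz0] at hz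
    rw [abs_of_nonneg (h.1 hz0)] at hw
    exact real_pow_sub d hd hr hz hw
  · have hw0 : ¬ 0 ≤ w := fun h' => hz0 (h.2 h')
    push Not at hz0 hw0
    rw [abs_of_neg hz0] at hz
    rw [abs_of_neg hw0] at hw
    have := real_pow_sub d hd hr hz hw
    rw [neg_pow z, neg_pow w, ← mul_sub, abs_mul, abs_pow, abs_neg, abs_one, one_pow, one_mul,
      neg_sub_neg, abs_sub_comm] at this
    exact this

section
variable (d : ℕ) (c : ℝ) (y : ℕ → ℝ) (hy : ∀ k, y (k+1) = y k ^ d + c) (R : ℝ)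

lemma arch_esc (hd : 2 ≤ d) (hy : ∀ k, y (k+1) = y k ^ d + c) 
    (hR1 : 1 ≤ R) (hR : R ^ d = max 1 |c|) (k : ℕ) (hk : 2 * R < |y k|) (m : ℕ) :
    (|y k| / 2) ^ (d ^ m) ≤ |y (k+m)| / 2 := by
  have ha : R < |y k| / 2 := by linarith
  induction m with
  | zero => simp
  | succ m ih =>
    have h0 : R < |y (k+m)| / 2 := by
      refine lt_of_lt_of_le ha (le_trans (le_self_pow₀ (by linarith) ?_) ih)
      positivity
    set a := |y (k+m)| / 2 with hadef
    have h1 : |y (k+m)| = 2 * a := by rw [hadef]; ring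
    have h2 : a ^ d ≤ |y (k+(m+1))| / 2 := by
      rw [← add_assoc, hy]
      have t : |y (k+m) ^ d| ≤ |y (k+m) ^ d + c| + |c| := by
        have := abs_sub (y (k+m) ^ d + c) c
        simpa using this
      have hc : |c| ≤ a ^ d := by
        calc |c| ≤ R ^ d := by rw [hR]; exact le_max_right _ _
          _ ≤ a ^ d := by gcongr
      have h4 : (4:ℝ) ≤ 2 ^ d := by
        calc (4:ℝ) = 2 ^ 2 := by norm_num
          _ ≤ 2 ^ d := pow_le_pow_right₀ (by norm_num) hd
      rw [abs_pow, h1, mul_pow] at t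
      have ha0 : 0 ≤ a ^ d := by positivity
      nlinarith
    refine le_trans ?_ h2
    rw [pow_succ, pow_mul]
    gcongr

lemma arch_nonesc (hd : 2 ≤ d) (hy : ∀ k, y (k+1) = y k ^ d + c) 
    (hR1 : 1 ≤ R) (hR : R ^ d = max 1 |c|) (M : ℕ)
    (hM : ∀ k ≤ M + 2, |y k| ≤ 2 * R) (i : ℕ) (hi : i ≤ M) (j : ℕ) (hj : j ≤ M)
    (h0 : 0 ≤ y i ↔ 0 ≤ y j) (h1 : 0 ≤ y (i+1) ↔ 0 ≤ y (j+1)) :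
    |y i - y j| * R ≤ 4 ^ (d+1) := by
  have htriv : ∀ i ≤ M + 2, ∀ j ≤ M + 2, |y i - y j| ≤ 4 * R := by
    intro i hi j hj
    have := abs_sub (y i) (y j)
    linarith [hM i hi, hM j hj]
  by_cases h4 : R ≤ 4
  · calc |y i - y j| * R ≤ 4 * R * R := by
          have := htriv i (by omega) j (by omega)
          gcongr
      _ ≤ 4 * 4 * 4 := by gcongr
      _ = 4 ^ 3 := by norm_num
      _ ≤ _ := pow_le_pow_right₀ (by norm_num) (by omega)
  push Not at h4
  have hcR : |c| = R ^ d := by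
    have : 1 < R ^ d := one_lt_pow₀ (by linarith) (by omega)
    rw [hR] at this ⊢
    rcases lt_max_iff.1 this with h | h
    · exact absurd h (lt_irrefl _)
    · exact (max_eq_right h.le).symm
  have hlow : ∀ k ≤ M + 1, R / 2 ≤ |y k| := by
    intro k hk
    by_contra hc
    push Not at hc
    have t1 : |c| ≤ |y (k+1)| + |y k ^ d| := by
      have := abs_sub (y (k+1)) (y k ^ d)
      rw [hy k] at this ⊢
      simpa using this
    have t2 : |y k ^ d| ≤ R ^ d / 4 := by
      rw [abs_pow]
      calc |y k| ^ d ≤ (R / 2) ^ d := by gcongr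
        _ = R ^ d / 2 ^ d := by rw [div_pow]
        _ ≤ R ^ d / 2 ^ 2 := by gcongr; norm_num
        _ = _ := by norm_num
    have t3 := hM (k+1) (by omega)
    have t4 : 4 * R ≤ R ^ d := by
      calc 4 * R ≤ R * R := by gcongr
        _ = R ^ 2 := by ring
        _ ≤ R ^ d := pow_le_pow_right₀ hR1 hd
    rw [hcR] at t1
    linarith
  have s0 := real_pow_sub' d hd (by linarith : 0 < R / 2) (hlow i (by omega)) (hlow j (by omega)) h0
  have s1 := real_pow_sub' d hd (by linarith : 0 < R / 2) (hlow (i+1) (by omega)) (hlow (j+1) (by omega)) h1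
  have e0 : y i ^ d - y j ^ d = y (i+1) - y (j+1) := by rw [hy, hy]; ring
  have e1 : y (i+1) ^ d - y (j+1) ^ d = y (i+2) - y (j+2) := by rw [hy (i+1), hy (j+1)]; ring
  rw [e0] at s0
  rw [e1] at s1
  have s2 := s1.trans (htriv (i+2) (by omega) (j+2) (by omega))
  set n := |y i - y j|
  have hn : 0 ≤ n := abs_nonneg _
  have hR0 : 0 < R := by linarith
  have s3 : n * (R / 2) ^ (d - 1) * (R / 2) ^ (d - 1) ≤ 4 * R := le_trans (by gcongr) s2
  obtain ⟨m, rfl⟩ : ∃ m, d = m + 2 := ⟨d - 2, by omega⟩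
  have e : m + 2 - 1 = m + 1 := rfl
  rw [e, div_pow] at s3
  have s4 : n * R * (R ^ m) ^ 2 ≤ 4 ^ (m + 2) := by
    have : (n * R * (R ^ m) ^ 2) * R ≤ 4 ^ (m + 2) * R := by
      have e4 : (4:ℝ) ^ (m+2) = (2 ^ (m + 1)) ^ 2 * 4 := by
        rw [← pow_mul, mul_comm (m+1), pow_mul]; norm_num; ring
      have h2 : (0:ℝ) < (2 ^ (m + 1)) ^ 2 := by positivity
      calc (n * R * (R ^ m) ^ 2) * R = (2 ^ (m + 1)) ^ 2 * (n * (R ^ (m + 1) / 2 ^ (m + 1)) * (R ^ (m + 1) / 2 ^ (m + 1))) := by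
            field_simp
            ring
        _ ≤ (2 ^ (m + 1)) ^ 2 * (4 * R) := by gcongr
        _ = _ := by rw [e4]; ring
    exact le_of_mul_le_mul_right this hR0
  have hRm : 1 ≤ (R ^ m) ^ 2 := one_le_pow₀ (one_le_pow₀ hR1)
  calc n * R = n * R * 1 := by ring
    _ ≤ n * R * (R ^ m) ^ 2 := by gcongr
    _ ≤ 4 ^ (m+2) := s4
    _ ≤ _ := pow_le_pow_right₀ (by norm_num) (by omega)

lemma arch_ineq (hd : 2 ≤ d) (hy : ∀ k, y (k+1) = y k ^ d + c) (M : ℕ)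
    (i : ℕ) (hi : i ≤ M) (j : ℕ) (hj : j ≤ M) (hij : y i ≠ y j)
    (h0 : 0 ≤ y i ↔ 0 ≤ y j) (h1 : 0 ≤ y (i+1) ↔ 0 ≤ y (j+1)) (K : ℕ) (hK : M + 3 ≤ K) :
    ((d ^ (K - (M+2)) : ℕ) : ℝ) * (d * Real.log |y i - y j| + Real.log (max 1 |c|)) ≤
     ((d ^ (K - (M+2)) : ℕ) : ℝ) * (d * (d + 1) * Real.log 4) + 2 * d * Real.log (max 1 |y K|) := by
  set T := d ^ (K - (M+2)) with hT
  obtain ⟨R, hR1, hR⟩ : ∃ R : ℝ, 1 ≤ R ∧ R ^ d = max 1 |c| := by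
    refine ⟨(max 1 |c|) ^ ((1:ℝ) / d), Real.one_le_rpow (le_max_left _ _) (by positivity), ?_⟩
    rw [← Real.rpow_natCast, ← Real.rpow_mul (by positivity), one_div, inv_mul_cancel₀ (by positivity), Real.rpow_one]
  rw [← hR, Real.log_pow]
  have hn : 0 < |y i - y j| := abs_pos.2 (sub_ne_zero.2 hij)
  have hR0 : 0 < R := by linarith
  have hd2 : (2:ℝ) ≤ d := by exact_mod_cast hd
  have hl4 : 0 ≤ Real.log 4 := Real.log_nonneg (by norm_num)
  have hlY : 0 ≤ Real.log (max 1 |y K|) := Real.log_nonneg (le_max_left _ _)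
  have hT0 : (0:ℝ) ≤ T := by positivity
  by_cases h : ∃ k ≤ M + 2, 2 * R < |y k|
  · obtain ⟨k, hk, h⟩ := h
    have key : ∀ k ≤ M + 2, 2 * R < |y k| → (|y k| / 2) ^ T ≤ max 1 |y K| := by
      intro k hk h
      have := arch_esc d c y R hd hy hR1 hR k h (K - k)
      rw [show k + (K - k) = K by omega] at this
      calc _ ≤ (|y k| / 2) ^ (d ^ (K - k)) := 
            pow_le_pow_right₀ (by linarith) (Nat.pow_le_pow_right (by omega) (by omega))
        _ ≤ |y K| / 2 := this
        _ ≤ |y K| := by linarith [abs_nonneg (y K)]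
        _ ≤ _ := le_max_right _ _
    have kR : R ^ T ≤ max 1 |y K| := by
      refine le_trans ?_ (key k hk h)
      gcongr
      linarith
    have kall : ∀ k ≤ M + 2, (|y k| / 2) ^ T ≤ max 1 |y K| := by
      intro k hk
      by_cases h : 2 * R < |y k|
      · exact key k hk h
      · push Not at h
        refine le_trans ?_ kR
        gcongr
        linarith
    have kd : (|y i - y j| / 4) ^ T ≤ max 1 |y K| := by
      have t := abs_sub (y i) (y j)
      rcases le_total |y i| |y j| with h | h
      · refine le_trans ?_ (kall j (by omega))
        gcongr ?_ ^ T
        linarith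
      · refine le_trans ?_ (kall i (by omega))
        gcongr ?_ ^ T
        linarith
    have l1 := Real.log_le_log (by positivity) kR
    have l2 := Real.log_le_log (by positivity) kd
    rw [Real.log_pow] at l1 l2
    rw [Real.log_div (by positivity) (by norm_num)] at l2
    have l3 : (T:ℝ) * (d * (1 * Real.log 4)) ≤ T * (d * ((d + 1) * Real.log 4)) := by
      gcongr; linarith
    have l4 := mul_le_mul_of_nonneg_left (add_le_add l1 l2) (by positivity : (0:ℝ) ≤ d)
    linarith
  · push Not at h
    have := arch_nonesc d c y R hd hy hR1 hR M h i hi j hj h0 h1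
    have l := Real.log_le_log (by positivity) this
    rw [Real.log_mul (by positivity) (by positivity), Real.log_pow] at l
    push_cast at l
    have l2 := mul_le_mul_of_nonneg_left l (by positivity : (0:ℝ) ≤ T * d)
    have l3 : 0 ≤ 2 * d * Real.log (max 1 |y K|) := by positivity
    linarith
end

lemma rh_eq (q : ℚ) : ratHeight q = Real.log q.den + Real.log (max 1 |(q:ℝ)|) := by
  have hd : (0:ℝ) < q.den := by exact_mod_cast q.den_pos
  rw [ratHeight, ← Real.log_mul hd.ne' (by positivity)]
  congr 1
  rw [mul_max_of_nonneg _ _ hd.le, mul_one, max_comm]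
  congr 1
  rw [← abs_of_pos hd, ← abs_mul, mul_comm]
  congr 1
  exact_mod_cast (Rat.mul_den_eq_num q).symm

lemma rh_nonneg (q : ℚ) : 0 ≤ ratHeight q := by
  apply Real.log_nonneg
  refine le_trans ?_ (le_max_right _ _)
  exact_mod_cast q.den_pos

lemma rh_pow (q : ℚ) (d : ℕ) : ratHeight (q ^ d) = d * ratHeight q := by
  rw [ratHeight, ratHeight, ← Real.log_pow, Rat.num_pow, Rat.den_pow]
  congr 1
  push_cast
  rw [abs_pow]
  rcases le_total |(q.num : ℝ)| (q.den : ℝ) with h | h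
  · rw [max_eq_right h, max_eq_right (by gcongr)]
  · rw [max_eq_left h, max_eq_left (by gcongr)]

lemma rh_sub (a b : ℚ) : ratHeight (a - b) ≤ ratHeight a + ratHeight b + Real.log 2 := by
  have ha : (0:ℝ) < a.den := by exact_mod_cast a.den_pos
  have hb : (0:ℝ) < b.den := by exact_mod_cast b.den_pos
  have hab : (0:ℝ) < (a - b).den := by exact_mod_cast (a - b).den_pos
  rw [rh_eq, rh_eq, rh_eq]
  have h1 : Real.log (a - b).den ≤ Real.log a.den + Real.log b.den := by
    rw [← Real.log_mul ha.ne' hb.ne']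
    apply Real.log_le_log hab
    exact_mod_cast Nat.le_of_dvd (by positivity) (Rat.sub_den_dvd a b)
  have h2 : Real.log (max 1 |((a - b : ℚ):ℝ)|) ≤ Real.log (max 1 |(a:ℝ)|) + Real.log (max 1 |(b:ℝ)|) + Real.log 2 := by
    rw [← Real.log_mul (by positivity) (by positivity), ← Real.log_mul (by positivity) (by positivity)]
    apply Real.log_le_log (by positivity)
    have a1 : 1 ≤ max 1 |(a:ℝ)| := le_max_left _ _
    have b1 : 1 ≤ max 1 |(b:ℝ)| := le_max_left _ _
    have a2 : |(a:ℝ)| ≤ max 1 |(a:ℝ)| := le_max_right _ _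
    have b2 : |(b:ℝ)| ≤ max 1 |(b:ℝ)| := le_max_right _ _
    apply max_le
    · nlinarith
    · push_cast
      have := abs_sub (a:ℝ) b
      nlinarith
  linarith

lemma rh_finite (H : ℝ) : {q : ℚ | ratHeight q ≤ H}.Finite := by
  obtain ⟨n, hn⟩ := exists_nat_ge (Real.exp H)
  apply Set.Finite.of_finite_image (f := fun q : ℚ => (q.num, q.den))
  · apply Set.Finite.subset ((Set.finite_Icc (-(n:ℤ)) n).prod (Set.finite_Iic n))
    rintro _ ⟨q, hq, rfl⟩
    have hd : (1:ℝ) ≤ q.den := by exact_mod_cast q.den_pos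
    have h1 : max (|q.num| : ℝ) (q.den : ℝ) ≤ n := by
      refine le_trans ?_ hn
      rw [← Real.log_le_iff_le_exp (lt_of_lt_of_le (by linarith) (le_max_right _ _))]
      exact hq
    have h2 := (le_max_left _ _).trans h1
    have h3 := (le_max_right _ _).trans h1
    rw [abs_le] at h2
    refine ⟨⟨?_, ?_⟩, ?_⟩
    · exact_mod_cast h2.1
    · exact_mod_cast h2.2
    · exact_mod_cast h3
  · intro a _ b _ h
    rw [Prod.mk.injEq] at h
    exact Rat.ext h.1 h.2

lemma small_case (d : ℕ) (hd : 2 ≤ d) (B : ℝ) (hB : 0 ≤ B) : ∃ C : ℝ, 0 < C ∧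
    ∀ (c : ℚ) (x : ℕ → ℚ), ratHeight c ≤ B → (∀ k, x (k+1) = x k ^ d + c) → Function.Injective x →
    ∀ L : ℝ, Tendsto (fun k : ℕ => ratHeight (x k) / (d : ℝ) ^ k) atTop (nhds L) → C ≤ L := by
  set A := B + Real.log 2 with hA
  have hA0 : 0 ≤ A := add_nonneg hB (Real.log_nonneg (by norm_num))
  have hfin := rh_finite (A + 1)
  set F := hfin.toFinset with hF
  have hd0 : (0:ℝ) < d := by positivity
  have hd2 : (2:ℝ) ≤ d := by exact_mod_cast hd
  refine ⟨((d:ℝ) ^ F.card)⁻¹, by positivity, fun c x hc hx hinj L hL => ?_⟩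
  obtain ⟨k, hk, hkh⟩ : ∃ k ≤ F.card, A + 1 < ratHeight (x k) := by
    by_contra hcon
    push Not at hcon
    have : (Finset.range (F.card + 1)).card ≤ F.card := by
      apply Finset.card_le_card_of_injOn x
      · intro k hk
        simp only [Finset.coe_range, Set.mem_Iio] at hk
        simp only [hF, Set.Finite.coe_toFinset, Set.mem_ofPred_eq]
        exact hcon k (by omega)
      · exact hinj.injOn
    simp at this
  have step : ∀ k, d * (ratHeight (x k) - A) ≤ ratHeight (x (k+1)) - A := by
    intro k
    have h1 := rh_sub (x (k+1)) c
    rw [hx k, add_sub_cancel_right, rh_pow, ← hx k] at h1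
    nlinarith
  have iter : ∀ m, (d:ℝ) ^ m ≤ ratHeight (x (k+m)) - A := by
    intro m
    induction m with
    | zero => simp; linarith
    | succ m ih =>
      refine le_trans ?_ (step (k+m))
      rw [pow_succ, mul_comm]
      gcongr
  refine le_trans (b := ((d:ℝ) ^ k)⁻¹) ?_ ?_
  · gcongr
    linarith
  · apply ge_of_tendsto hL
    filter_upwards [eventually_ge_atTop k] with K hK
    have := iter (K - k)
    rw [show k + (K - k) = K by omega] at this
    have e : (d:ℝ) ^ K = (d:ℝ) ^ k * (d:ℝ) ^ (K - k) := by
      rw [← pow_add]; congr 1; omega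
    rw [le_div_iff₀ (by positivity), e, inv_mul_cancel_left₀ (by positivity)]
    linarith

lemma main_ineq (d : ℕ) (hd : 2 ≤ d) (s : ℕ) (c : ℚ) (x : ℕ → ℚ)
    (hs : {p : ℕ | p.Prime ∧ padicValRat p c < 0 ∧ (d : ℤ) ∣ padicValRat p c}.ncard = s)
    (hx : ∀ k, x (k+1) = x k ^ d + c) (hinj : Function.Injective x) (M : ℕ)
    (hM : M = (d * d) ^ s * 4) (K : ℕ) (hK : M + 3 ≤ K) :
    ((d ^ (K - (M+2)) : ℕ) : ℝ) * (ratHeight c - (d * (d + 1) * Real.log 4 + 4 * d * Real.log d)) ≤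
      (d * d + d) * ratHeight (x K) := by
  classical
  set S := {p : ℕ | p.Prime ∧ padicValRat p c < 0 ∧ (d : ℤ) ∣ padicValRat p c} with hSdef
  have hSfin : S.Finite := by
    apply (Set.finite_Iic c.den).subset
    rintro p ⟨hp, hc, -⟩
    have := Fact.mk hp
    have hp1 : 1 < (p:ℚ) := by exact_mod_cast hp.one_lt
    have hE : 1 < mx p c := by
      refine lt_of_lt_of_le ?_ (np_le_mx _ _)
      rw [padicNorm.eq_zpow_of_nonzero (by rintro rfl; simp at hc)]
      exact one_lt_zpow₀ hp1 (by omega)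
    have h1 := den_norm p c
    apply Nat.le_of_dvd c.den_pos
    rw [← padicNorm.nat_lt_one_iff]
    have h2 := padicNorm.nonneg (p := p) (c.den : ℚ)
    by_contra h3
    push Not at h3
    nlinarith
  have hcol : ∀ p : hSfin.toFinset, ∃ f : ℕ → Fin d × Fin d, ∀ i ≤ M, ∀ j ≤ M, f i = f j → 
      ∀ K, M + 3 ≤ K → (padicNorm p (x i - x j) ^ d * padicNorm p d ^ (4 * d) * mx p c) ^ (d ^ (K - (M+2)))
      ≤ mx p (x K) ^ (d * d + d) := by
    rintro ⟨p, hp⟩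
    rw [Set.Finite.mem_toFinset] at hp
    have := Fact.mk hp.1
    exact local_bad p d c x hx hd hinj hp.2.1 M
  choose f hf using hcol
  let col : Fin (M+1) → (hSfin.toFinset → Fin d × Fin d) × (Bool × Bool) :=
    fun i => (fun p => f p i, (decide (0 ≤ x i), decide (0 ≤ x (i+1))))
  obtain ⟨i, j, hij, hcij⟩ := Fintype.exists_ne_map_eq_of_card_lt col (by
    rw [Set.ncard_eq_toFinset_card _ hSfin] at hs
    simp only [Fintype.card_prod, Fintype.card_fun, Fintype.card_fin, Fintype.card_bool,
      Fintype.card_coe, hs]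
    omega)
  simp only [col, Prod.mk.injEq, decide_eq_decide] at hcij
  obtain ⟨hc1, hc2, hc3⟩ := hcij
  have hi := Nat.lt_succ_iff.1 i.2
  have hj := Nat.lt_succ_iff.1 j.2
  have hne : x i ≠ x j := fun h => hij (Fin.ext (hinj h))
  have hG := global_ineq d hd c x i j M K hne (by
    intro p _
    by_cases hp : p ∈ S
    · exact hf ⟨p, by simpa using hp⟩ i hi j hj (congrFun hc1 _) K hK
    · refine local_good p d c x hx hd ?_ M i hi j hj K hK
      intro h
      exact hp ⟨Fact.out, h⟩)
  have hA := arch_ineq d (c:ℝ) (fun k => (x k : ℝ)) hd (fun k => by simp only [hx]; push_cast; rfl) M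
    i hi j hj (by simpa using hne) (by simpa using hc2) (by simpa using hc3) K hK
  rw [rh_eq, rh_eq]
  push_cast at hG hA ⊢
  have hd2 : (2:ℝ) ≤ d := by exact_mod_cast hd
  have hlY : 0 ≤ Real.log (max 1 |(x K:ℝ)|) := Real.log_nonneg (le_max_left _ _)
  have : 2 * d * Real.log (max 1 |(x K:ℝ)|) ≤ (d * d + d) * Real.log (max 1 |(x K:ℝ)|) := by
    gcongr
    nlinarith
  linarith

theorem canonical_height_lower_bound (d : ℕ) (hd : 2 ≤ d) (s : ℕ) :
    ∃ C : ℝ, 0 < C ∧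
      ∀ c : ℚ,
        {p : ℕ | p.Prime ∧ padicValRat p c < 0 ∧ (d : ℤ) ∣ padicValRat p c}.ncard = s →
        ∀ α : ℚ,
          (∀ i j : ℕ, i ≠ j → (fun z : ℚ => z ^ d + c)^[i] α ≠ (fun z : ℚ => z ^ d + c)^[j] α) →
          ∀ L : ℝ,
            Tendsto (fun k : ℕ => ratHeight ((fun z : ℚ => z ^ d + c)^[k] α) / (d : ℝ) ^ k)
              atTop (nhds L) →
            C * max (ratHeight c) 1 ≤ L := by
  set B : ℝ := d * (d + 1) * Real.log 4 + 4 * d * Real.log d with hB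
  have hd2 : (2:ℝ) ≤ d := by exact_mod_cast hd
  have hB0 : 0 ≤ B := by
    have h1 : 0 ≤ Real.log 4 := Real.log_nonneg (by norm_num)
    have h2 : 0 ≤ Real.log d := Real.log_nonneg (by linarith)
    positivity
  obtain ⟨C1, hC1, h1⟩ := small_case d hd (2 * B + 1) (by linarith)
  set M := (d * d) ^ s * 4 with hM
  set C2 : ℝ := 1 / (2 * ((d:ℝ) * d + d) * (d:ℝ) ^ (M + 2)) with hC2
  have hC2pos : 0 < C2 := by positivity
  refine ⟨min (C1 / (2 * B + 1)) C2, by positivity, fun c hs α hα L hL => ?_⟩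
  set x : ℕ → ℚ := fun k => (fun z : ℚ => z ^ d + c)^[k] α with hxdef
  have hx : ∀ k, x (k+1) = x k ^ d + c := by
    intro k
    simp only [hxdef, Function.iterate_succ_apply']
  have hinj : Function.Injective x := by
    intro i j h
    by_contra hne
    exact hα i j hne h
  rcases le_or_gt (ratHeight c) (2 * B + 1) with hc | hc
  · have := h1 c x hc hx hinj L hL
    calc _ ≤ C1 / (2 * B + 1) * (2 * B + 1) := by
          gcongr
          · exact min_le_left _ _
          · exact max_le hc (by linarith)
      _ = C1 := by field_simp
      _ ≤ L := this
  · rw [max_eq_left (by linarith)]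
    have hlim : (ratHeight c - B) / (((d:ℝ) * d + d) * (d:ℝ) ^ (M + 2)) ≤ L := by
      apply ge_of_tendsto hL
      filter_upwards [eventually_ge_atTop (M + 3)] with K hK
      have := main_ineq d hd s c x hs hx hinj M hM K hK
      rw [← hB] at this
      rw [div_le_div_iff₀ (by positivity) (by positivity)]
      have e : (d:ℝ) ^ K = ((d ^ (K - (M+2)) : ℕ) : ℝ) * (d:ℝ) ^ (M+2) := by
        push_cast
        rw [← pow_add]; congr 1; omega
      rw [e]
      have h3 := mul_le_mul_of_nonneg_right this (by positivity : (0:ℝ) ≤ (d:ℝ) ^ (M+2))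
      change _ ≤ ratHeight (x K) * _
      linarith
    refine le_trans ?_ hlim
    calc _ ≤ C2 * ratHeight c := by
          gcongr
          · exact rh_nonneg c
          · exact min_le_right _ _
      _ = (ratHeight c / 2) / (((d:ℝ) * d + d) * (d:ℝ) ^ (M + 2)) := by
          rw [hC2]; field_simp
      _ ≤ _ := by
          gcongr
          linarith
end

section
/- Let c be an integer with c ≥ 1 and φ(z) = z² + c as a map ℚ → ℚ. Then for every α ∈ ℚ, every real number L such that h(φ^[k](α))/2^k tends to L as k → ∞ satisfies L ≥ (log 2 / 4)·max(log c, 1). -/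
open Filter

lemma log_le_ratHeight (q : ℚ) (hq : 0 < q) : Real.log (q : ℝ) ≤ ratHeight q := by
  unfold ratHeight
  have hq' : (0 : ℝ) < q := by exact_mod_cast hq
  apply Real.log_le_log hq'
  refine le_trans ?_ (le_max_left _ _)
  have hd : (1 : ℝ) ≤ q.den := by exact_mod_cast q.pos
  have h : (q : ℝ) = (q.num : ℝ) / q.den := Rat.cast_def q
  have hn : (0 : ℝ) ≤ q.num := by exact_mod_cast (Rat.num_pos.mpr hq).le
  rw [h, abs_of_nonneg (by exact_mod_cast hn)]
  exact div_le_self (by exact_mod_cast hn) hd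

lemma iter_lower (c : ℤ) (hc : 1 ≤ c) (α : ℚ) (k : ℕ) :
    ((c : ℚ) ^ 2 + c) ^ (2 ^ k) ≤ (fun z : ℚ => z ^ 2 + (c : ℚ))^[k + 2] α := by
  have hc' : (1 : ℚ) ≤ c := by exact_mod_cast hc
  induction k with
  | zero =>
    simp only [Function.iterate_succ, Function.iterate_zero, Function.comp, id]
    have := sq_nonneg α
    simp only [pow_zero, pow_one]
    nlinarith
  | succ k ih =>
    rw [show k + 1 + 2 = (k + 2) + 1 by ring, Function.iterate_succ_apply', pow_succ 2 k, pow_mul]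
    have : (0 : ℚ) ≤ ((c : ℚ) ^ 2 + c) ^ (2 ^ k) := by positivity
    have := pow_le_pow_left₀ this ih 2
    linarith

theorem quadratic_positive_c_height_lower_bound (c : ℤ) (hc : 1 ≤ c) (α : ℚ) :
    ∀ L : ℝ,
      Tendsto (fun k : ℕ =>
          ratHeight ((fun z : ℚ => z ^ 2 + (c : ℚ))^[k] α) / (2 : ℝ) ^ k)
        atTop (nhds L) →
      (Real.log 2 / 4) * max (Real.log (c : ℝ)) 1 ≤ L := by
  intro L hL
  have hc' : (1 : ℝ) ≤ c := by exact_mod_cast hc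
  have hcq : (1 : ℚ) ≤ c := by exact_mod_cast hc
  have hl2 : Real.log 2 ≤ 1 := by have := Real.log_two_lt_d9; linarith
  have hlc : 0 ≤ Real.log (c : ℝ) := Real.log_nonneg hc'
  have h1 : Real.log 2 ≤ Real.log ((c : ℝ) ^ 2 + c) := Real.log_le_log (by norm_num) (by nlinarith)
  have h2 : Real.log c ≤ Real.log ((c : ℝ) ^ 2 + c) :=
    Real.log_le_log (by linarith) (by nlinarith)
  have h3 : (Real.log 2 / 4) * max (Real.log (c : ℝ)) 1 ≤ Real.log ((c : ℝ) ^ 2 + c) / 4 := by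
    rcases max_choice (Real.log (c : ℝ)) 1 with h | h <;> rw [h] <;> nlinarith
  refine h3.trans (ge_of_tendsto ((tendsto_add_atTop_iff_nat 2).mpr hL) (Eventually.of_forall ?_))
  intro k
  have hk := iter_lower c hc α k
  have hp : (0 : ℚ) < ((c : ℚ) ^ 2 + c) ^ (2 ^ k) := by positivity
  have hh := log_le_ratHeight _ (hp.trans_le hk)
  have hkr : ((c : ℝ) ^ 2 + c) ^ (2 ^ k) ≤
      (((fun z : ℚ => z ^ 2 + (c : ℚ))^[k + 2] α : ℚ) : ℝ) := by exact_mod_cast hk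
  have h4 := Real.log_le_log (by positivity) hkr
  rw [Real.log_pow] at h4
  push_cast at h4
  rw [le_div_iff₀ (by positivity), pow_add]
  linarith
end
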